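/- For every N≥2, β,ε>0 and h₀∈ℝ, with λ_N(η_{[2,N]}) = (1/2)·log( Z_{β,ε,h₀,N}[(−1,η_{[2,N]})] / Z_{β,ε,h₀,N}[(+1,η_{[2,N]})] ), the true joint measure satisfies the two consistency equations: (1) Σ_{σ₁=±1} K_{β,ε,h₀,N}(σ₁=σ₁)·σ₁ = Σ_{σ_{[2,N]},η_{[2,N]}} K_{β,ε,h₀,N}(σ_{[2,N]},η_{[2,N]}) · ( Σ_{σ₁=±1} π_{λ_N(η_{[2,N]});β,ε,h₀}[(1/N)Σ_{i=2}^N σ_i](σ₁)·σ₁ ), and (2) 0 = Σ_{σ_{[2,N]},η_{[2,N]}} K_{β,ε,h₀,N}(σ_{[2,N]},η_{[2,N]}) · ( Σ_{η₁=±1} π_{λ_N(η_{[2,N]});β,ε,h₀}[(1/N)Σ_{i=2}^N σ_i](η₁)·η₁ ), where K_{β,ε,h₀,N}(σ_{[2,N]},η_{[2,N]}) denotes the marginal on sites 2,…,N and the single-site marginals of π are obtained by summing π[m](σ₁,η₁) over the other variable. -/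

import Mathlib

open Real Filter
open scoped Classical BigOperators

noncomputable section

/-- Map a Boolean to a ±1 spin value. -/
def spin (b : Bool) : ℝ := if b then 1 else -1

/-- Hamiltonian (with sign absorbed) of the quenched random field Curie–Weiss model. -/
def qH (N : ℕ) (β ε h₀ : ℝ) (σ η : Fin N → Bool) : ℝ :=
  β / (2 * N) * (∑ i, spin (σ i)) ^ 2 + β * ∑ i, (ε * spin (η i) + h₀) * spin (σ i)

/-- Quenched partition function `Z_{β,ε,h₀,N}[η]`. -/
def qZ (N : ℕ) (β ε h₀ : ℝ) (η : Fin N → Bool) : ℝ :=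
  ∑ σ : Fin N → Bool, Real.exp (qH N β ε h₀ σ η)

/-- Quenched Gibbs measure `μ_{β,ε,h₀,N}[η](σ)`. -/
def quenched (N : ℕ) (β ε h₀ : ℝ) (η σ : Fin N → Bool) : ℝ :=
  Real.exp (qH N β ε h₀ σ η) / qZ N β ε h₀ η

/-- True joint measure `K_{β,ε,h₀,N}(σ,η) = 2^{-N}·μ[η](σ)`. -/
def jointK (N : ℕ) (β ε h₀ : ℝ) (σ η : Fin N → Bool) : ℝ :=
  ((2 : ℝ) ^ N)⁻¹ * quenched N β ε h₀ η σ

/-- The random Morita chemical potential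
`λ_N(η_{[2,N]}) = (1/2)·log(Z[(−1,η_{[2,N]})]/Z[(+1,η_{[2,N]})])`; site 1 is index `0`,
`true` codes `+1` and `false` codes `−1`. -/
def lamN (n : ℕ) (β ε h₀ : ℝ) (ηr : Fin n → Bool) : ℝ :=
  1 / 2 * Real.log (qZ (n + 1) β ε h₀ (Fin.cons false ηr) / qZ (n + 1) β ε h₀ (Fin.cons true ηr))

/-- The single-site joint kernel `π_{λ;β,ε,h₀}[m](σ₁,η₁)`. -/
def piK (β ε h₀ lam m : ℝ) (s t : Bool) : ℝ :=
  Real.exp (β * (m + ε * spin t + h₀) * spin s + lam * spin t) /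
    (2 * (Real.cosh (β * (m + ε + h₀)) * Real.exp lam
        + Real.cosh (β * (m - ε + h₀)) * Real.exp (-lam)))

lemma qZ_pos (N : ℕ) (β ε h₀ : ℝ) (η : Fin N → Bool) : 0 < qZ N β ε h₀ η :=
  Finset.sum_pos (fun _ _ => Real.exp_pos _) Finset.univ_nonempty

lemma spin_sq (s : Bool) : spin s ^ 2 = 1 := by
  cases s <;> simp [spin]

lemma qH_cons (n : ℕ) (β ε h₀ : ℝ) (σr ηr : Fin n → Bool) (s t : Bool) :
    qH (n + 1) β ε h₀ (Fin.cons s σr) (Fin.cons t ηr)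
      = (β / (2 * ((n : ℝ) + 1)) * ((∑ i, spin (σr i)) ^ 2 + 1)
          + β * ∑ i, (ε * spin (ηr i) + h₀) * spin (σr i))
        + β * ((((n : ℝ) + 1)⁻¹ * ∑ i, spin (σr i)) + ε * spin t + h₀) * spin s := by
  have hn : (n : ℝ) + 1 ≠ 0 := by positivity
  unfold qH
  rw [Fin.sum_univ_succ, Fin.sum_univ_succ]
  simp only [Fin.cons_zero, Fin.cons_succ]
  push_cast
  have h := spin_sq s
  generalize (∑ i, spin (σr i)) = M
  generalize (∑ i, (ε * spin (ηr i) + h₀) * spin (σr i)) = L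
  rw [show (spin s + M) ^ 2 = M ^ 2 + 1 + 2 * M * spin s by rw [← h]; ring]
  field_simp
  ring

lemma exp_lam (a b : ℝ) (ha : 0 < a) (hb : 0 < b) (t : Bool) :
    (if t then b else a)⁻¹ =
      (Real.exp (1 / 2 * (Real.log a + Real.log b)))⁻¹ *
        Real.exp (1 / 2 * Real.log (a / b) * spin t) := by
  rw [Real.log_div ha.ne' hb.ne', ← Real.exp_neg, ← Real.exp_add]
  cases t
  · rw [if_neg (by simp), show a⁻¹ = Real.exp (-Real.log a) by rw [Real.exp_neg, Real.exp_log ha]]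
    congr 1
    simp [spin]; ring
  · rw [if_pos rfl, show b⁻¹ = Real.exp (-Real.log b) by rw [Real.exp_neg, Real.exp_log hb]]
    congr 1
    simp [spin]; ring

lemma piK_sum (β ε h₀ lam m : ℝ) : ∑ s : Bool, ∑ t : Bool, piK β ε h₀ lam m s t = 1 := by
  have hc1 := Real.cosh_pos (β * (m + ε + h₀))
  have hc2 := Real.cosh_pos (β * (m - ε + h₀))
  have hpos : 0 < 2 * (Real.cosh (β * (m + ε + h₀)) * Real.exp lam
        + Real.cosh (β * (m - ε + h₀)) * Real.exp (-lam)) := by positivity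
  unfold piK
  simp only [← Finset.sum_div]
  rw [div_eq_one_iff_eq hpos.ne']
  simp only [Fintype.sum_bool, spin, Real.cosh_eq, Real.exp_add]
  simp
  ring_nf

lemma jointK_prop (n : ℕ) (β ε h₀ : ℝ) (σr ηr : Fin n → Bool) : ∃ A : ℝ, ∀ s t,
    jointK (n + 1) β ε h₀ (Fin.cons s σr) (Fin.cons t ηr)
      = A * piK β ε h₀ (lamN n β ε h₀ ηr) (((n : ℝ) + 1)⁻¹ * ∑ i, spin (σr i)) s t := by
  set m := ((n : ℝ) + 1)⁻¹ * ∑ i, spin (σr i) with hm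
  set lam := lamN n β ε h₀ ηr with hlam
  have hc1 := Real.cosh_pos (β * (m + ε + h₀))
  have hc2 := Real.cosh_pos (β * (m - ε + h₀))
  have hpos : 0 < 2 * (Real.cosh (β * (m + ε + h₀)) * Real.exp lam
        + Real.cosh (β * (m - ε + h₀)) * Real.exp (-lam)) := by positivity
  set D := 2 * (Real.cosh (β * (m + ε + h₀)) * Real.exp lam
        + Real.cosh (β * (m - ε + h₀)) * Real.exp (-lam)) with hD
  refine ⟨((2 : ℝ) ^ (n + 1))⁻¹ * Real.exp (β / (2 * ((n : ℝ) + 1)) * ((∑ i, spin (σr i)) ^ 2 + 1)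
          + β * ∑ i, (ε * spin (ηr i) + h₀) * spin (σr i)) *
      (Real.exp (1 / 2 * (Real.log (qZ (n + 1) β ε h₀ (Fin.cons false ηr))
        + Real.log (qZ (n + 1) β ε h₀ (Fin.cons true ηr)))))⁻¹ * D, fun s t => ?_⟩
  have hZ := exp_lam _ _ (qZ_pos (n + 1) β ε h₀ (Fin.cons false ηr))
    (qZ_pos (n + 1) β ε h₀ (Fin.cons true ηr)) t
  have hZ' : (if t then qZ (n + 1) β ε h₀ (Fin.cons true ηr)
      else qZ (n + 1) β ε h₀ (Fin.cons false ηr)) = qZ (n + 1) β ε h₀ (Fin.cons t ηr) := by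
    cases t <;> simp
  rw [hZ'] at hZ
  change _ = _ * Real.exp (lam * spin t) at hZ
  unfold jointK quenched piK
  rw [← hD, div_eq_mul_inv, hZ, qH_cons, ← hm, Real.exp_add, Real.exp_add (_ * spin s)]
  field_simp

lemma jointK_mul (n : ℕ) (β ε h₀ : ℝ) (σr ηr : Fin n → Bool) (s t : Bool) :
    (∑ s : Bool, ∑ t : Bool, jointK (n + 1) β ε h₀ (Fin.cons s σr) (Fin.cons t ηr)) *
      piK β ε h₀ (lamN n β ε h₀ ηr) (((n : ℝ) + 1)⁻¹ * ∑ i, spin (σr i)) s t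
      = jointK (n + 1) β ε h₀ (Fin.cons s σr) (Fin.cons t ηr) := by
  obtain ⟨A, hA⟩ := jointK_prop n β ε h₀ σr ηr
  simp only [hA, ← Finset.mul_sum, piK_sum, mul_one]

lemma sum_cons (n : ℕ) (f : (Fin (n + 1) → Bool) → ℝ) :
    ∑ σ, f σ = ∑ σr : Fin n → Bool, ∑ s : Bool, f (Fin.cons s σr) := by
  rw [← (Fin.consEquiv (fun _ : Fin (n + 1) => Bool)).sum_comp, Fintype.sum_prod_type_right]
  rfl

lemma quenched_sum (N : ℕ) (β ε h₀ : ℝ) (η : Fin N → Bool) :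
    ∑ σ, quenched N β ε h₀ η σ = 1 := by
  unfold quenched
  rw [← Finset.sum_div]
  exact div_self (qZ_pos N β ε h₀ η).ne'

/-- The two consistency equations for the true joint measure (`N = n+1 ≥ 2`):
the expected spin at site 1 is the average over the outer configuration of the
σ-marginal mean of the kernel `π`, and the expected random field at site 1 vanishes,
being the average of the η-marginal mean of `π`. -/
theorem stmt15 (n : ℕ) (hn : 1 ≤ n) (β ε h₀ : ℝ) (hβ : 0 < β) (hε : 0 < ε) :
    (∑ σ : Fin (n + 1) → Bool, ∑ η : Fin (n + 1) → Bool,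
        jointK (n + 1) β ε h₀ σ η * spin (σ 0)
      = ∑ σr : Fin n → Bool, ∑ ηr : Fin n → Bool,
          (∑ s : Bool, ∑ t : Bool, jointK (n + 1) β ε h₀ (Fin.cons s σr) (Fin.cons t ηr)) *
          (∑ s : Bool,
            (∑ t : Bool, piK β ε h₀ (lamN n β ε h₀ ηr)
              (((n : ℝ) + 1)⁻¹ * ∑ i, spin (σr i)) s t) * spin s)) ∧
    ((0 : ℝ)
      = ∑ σr : Fin n → Bool, ∑ ηr : Fin n → Bool,
          (∑ s : Bool, ∑ t : Bool, jointK (n + 1) β ε h₀ (Fin.cons s σr) (Fin.cons t ηr)) *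
          (∑ t : Bool,
            (∑ s : Bool, piK β ε h₀ (lamN n β ε h₀ ηr)
              (((n : ℝ) + 1)⁻¹ * ∑ i, spin (σr i)) s t) * spin t)) := by
  constructor
  · rw [sum_cons]
    refine Finset.sum_congr rfl fun σr _ => ?_
    simp_rw [sum_cons n (fun η => _ * _)]
    rw [Finset.sum_comm]
    refine Finset.sum_congr rfl fun ηr _ => ?_
    rw [Finset.mul_sum]
    refine Finset.sum_congr rfl fun s _ => ?_
    rw [← mul_assoc, Finset.mul_sum, Finset.sum_mul]
    refine Finset.sum_congr rfl fun t _ => ?_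
    rw [jointK_mul, Fin.cons_zero]
  · have h0 : ∑ σ : Fin (n + 1) → Bool, ∑ η : Fin (n + 1) → Bool,
        jointK (n + 1) β ε h₀ σ η * spin (η 0) = 0 := by
      rw [Finset.sum_comm]
      have : ∀ η : Fin (n + 1) → Bool, ∑ σ, jointK (n + 1) β ε h₀ σ η * spin (η 0)
          = ((2 : ℝ) ^ (n + 1))⁻¹ * spin (η 0) := by
        intro η
        unfold jointK
        rw [← Finset.sum_mul, ← Finset.mul_sum, quenched_sum, mul_one]
      simp_rw [this]
      rw [sum_cons]
      simp [spin]
    rw [← h0, sum_cons]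
    refine Finset.sum_congr rfl fun σr _ => ?_
    simp_rw [sum_cons n (fun η => _ * _)]
    rw [Finset.sum_comm]
    refine Finset.sum_congr rfl fun ηr _ => ?_
    rw [Finset.sum_comm]
    rw [Finset.mul_sum]
    refine Finset.sum_congr rfl fun s _ => ?_
    rw [← mul_assoc, Finset.mul_sum, Finset.sum_mul]
    refine Finset.sum_congr rfl fun t _ => ?_
    rw [jointK_mul, Fin.cons_zero]
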